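/- arXiv:2108.12209 — 2 statements merged into one kernel-verified Lean document; each statement's English description precedes it below -/
import Mathlib

section
/- For every β > 0 and every t ∈ ℝ, the function ω ↦ (2e^{−βω/2}/(1 + e^{−βω}))·e^{−iωt} (whose modulus equals sech(βω/2)) is integrable on ℝ and ∫_ℝ (2e^{−βω/2}/(1 + e^{−βω}))·e^{−iωt} dω = 2π/(β·cosh(πt/β)). -/
open MeasureTheory

/-- Under the substitution `x = sigmoid y`, the Beta integrand becomes
`sigmoid y ^ u * (1 - sigmoid y) ^ v`. -/
lemma abs_deriv_sigmoid_smul_beta_integrand (u v : ℂ) (y : ℝ) :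
    |Real.sigmoid y * (1 - Real.sigmoid y)| •
        ((Real.sigmoid y : ℂ) ^ (u - 1) * (1 - (Real.sigmoid y : ℂ)) ^ (v - 1)) =
      (Real.sigmoid y : ℂ) ^ u * (1 - (Real.sigmoid y : ℂ)) ^ v := by
  have h₀ := Real.sigmoid_pos y
  have h₁ : 0 < 1 - Real.sigmoid y := sub_pos.2 (Real.sigmoid_lt_one y)
  have hx : (Real.sigmoid y : ℂ) ≠ 0 := Complex.ofReal_ne_zero.2 h₀.ne'
  have hx' : 1 - (Real.sigmoid y : ℂ) ≠ 0 := by exact_mod_cast h₁.ne'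
  rw [abs_of_pos (mul_pos h₀ h₁), Complex.cpow_sub _ _ hx, Complex.cpow_sub _ _ hx',
    Complex.cpow_one, Complex.cpow_one, Complex.real_smul]
  push_cast
  field_simp

lemma integrable_sigmoid_cpow_mul {u v : ℂ} (hu : 0 < u.re) (hv : 0 < v.re) :
    Integrable fun y : ℝ => (Real.sigmoid y : ℂ) ^ u * (1 - (Real.sigmoid y : ℂ)) ^ v := by
  have h := (intervalIntegrable_iff_integrableOn_Ioo_of_le zero_le_one).1
    (Complex.betaIntegral_convergent hu hv)
  rw [← Real.range_sigmoid, ← Set.image_univ,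
    integrableOn_image_iff_integrableOn_abs_deriv_smul MeasurableSet.univ
      (fun y _ => (Real.hasDerivAt_sigmoid y).hasDerivWithinAt)
      Real.sigmoid_injective.injOn, integrableOn_univ] at h
  simpa only [abs_deriv_sigmoid_smul_beta_integrand] using h

lemma integral_sigmoid_cpow_mul (u v : ℂ) :
    ∫ y : ℝ, (Real.sigmoid y : ℂ) ^ u * (1 - (Real.sigmoid y : ℂ)) ^ v =
      Complex.betaIntegral u v := by
  rw [Complex.betaIntegral, intervalIntegral.integral_of_le zero_le_one,
    integral_Ioc_eq_integral_Ioo, ← Real.range_sigmoid, ← Set.image_univ,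
    integral_image_eq_integral_abs_deriv_smul MeasurableSet.univ
      (fun y _ => (Real.hasDerivAt_sigmoid y).hasDerivWithinAt)
      Real.sigmoid_injective.injOn, setIntegral_univ]
  simp only [abs_deriv_sigmoid_smul_beta_integrand]

lemma sigmoid_cpow_mul_one_sub_cpow (u : ℂ) (y : ℝ) :
    (Real.sigmoid y : ℂ) ^ u * (1 - (Real.sigmoid y : ℂ)) ^ (1 - u) =
      Real.sigmoid y * Complex.exp (-(1 - u) * y) := by
  have h₀ := Real.sigmoid_pos y
  have hx : (Real.sigmoid y : ℂ) ≠ 0 := Complex.ofReal_ne_zero.2 h₀.ne'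
  have h : 1 - (Real.sigmoid y : ℂ) = (Real.sigmoid y : ℂ) * (Real.exp (-y) : ℝ) := by
    rw [← Complex.ofReal_mul, Real.sigmoid_mul_rexp_neg, Real.sigmoid_neg]
    push_cast
    rfl
  rw [h, Complex.mul_cpow_ofReal_nonneg h₀.le (Real.exp_pos _).le, ← mul_assoc,
    ← Complex.cpow_add _ _ hx, add_sub_cancel, Complex.cpow_one,
    Complex.cpow_def_of_ne_zero (Complex.ofReal_ne_zero.2 (Real.exp_pos _).ne'),
    ← Complex.ofReal_log (Real.exp_pos _).le, Real.log_exp]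
  congr 2
  push_cast
  ring

lemma betaIntegral_one_sub {u : ℂ} (hu : 0 < u.re) (hu' : u.re < 1) :
    Complex.betaIntegral u (1 - u) = Real.pi / Complex.sin (Real.pi * u) := by
  rw [Complex.betaIntegral_eq_Gamma_mul_div u (1 - u) hu (by simpa using hu'),
    Complex.Gamma_mul_Gamma_one_sub, add_sub_cancel, Complex.Gamma_one, div_one]

/-- Fourier transform of `ω ↦ 2e^{−βω/2}/(1+e^{−βω}) = sech(βω/2)`:
for every `β > 0` and `t ∈ ℝ`, the function
`ω ↦ (2e^{−βω/2}/(1+e^{−βω}))·e^{−iωt}` is integrable on `ℝ` and its integral equals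
`2π/(β·cosh(πt/β))`. -/
theorem sech_fourier_integral (β : ℝ) (hβ : 0 < β) (t : ℝ) :
    Integrable (fun ω : ℝ =>
      ((2 * Real.exp (-(β * ω) / 2) / (1 + Real.exp (-(β * ω))) : ℝ) : ℂ) *
        Complex.exp (-(Complex.I * (ω : ℂ) * (t : ℂ)))) ∧
    (∫ ω : ℝ, ((2 * Real.exp (-(β * ω) / 2) / (1 + Real.exp (-(β * ω))) : ℝ) : ℂ) *
        Complex.exp (-(Complex.I * (ω : ℂ) * (t : ℂ)))) =
      ((2 * Real.pi / (β * Real.cosh (Real.pi * t / β)) : ℝ) : ℂ) := by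
  have hβ' : (β : ℂ) ≠ 0 := Complex.ofReal_ne_zero.2 hβ.ne'
  set u : ℂ := 1 / 2 - (t / β : ℝ) * Complex.I with hu_def
  have hu_re : u.re = 1 / 2 := by simp [hu_def]
  have hu : 0 < u.re := by rw [hu_re]; norm_num
  have hu' : u.re < 1 := by rw [hu_re]; norm_num
  have h_integrand : ∀ ω : ℝ,
      ((2 * Real.exp (-(β * ω) / 2) / (1 + Real.exp (-(β * ω))) : ℝ) : ℂ) *
        Complex.exp (-(Complex.I * (ω : ℂ) * (t : ℂ))) =
      2 * ((Real.sigmoid (β * ω) : ℂ) ^ u * (1 - (Real.sigmoid (β * ω) : ℂ)) ^ (1 - u)) := by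
    intro ω
    have h_exp : -(1 - u) * ((β * ω : ℝ) : ℂ) =
        ((-(β * ω) / 2 : ℝ) : ℂ) + -(Complex.I * (ω : ℂ) * (t : ℂ)) := by
      rw [hu_def]
      push_cast
      field_simp
      ring
    rw [sigmoid_cpow_mul_one_sub_cpow, h_exp, Complex.exp_add, Real.sigmoid_def]
    push_cast
    ring
  have h_sin : Complex.sin (Real.pi * u) = (Real.cosh (Real.pi * t / β) : ℝ) := by
    have : (Real.pi : ℂ) * u = Real.pi / 2 - (Real.pi * t / β : ℝ) * Complex.I := by
      rw [hu_def]
      push_cast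
      ring
    rw [this, Complex.sin_pi_div_two_sub, Complex.cos_mul_I, Complex.ofReal_cosh]
  simp only [h_integrand]
  refine ⟨((integrable_sigmoid_cpow_mul hu (by simpa using hu')).comp_mul_left' hβ.ne').const_mul 2,
    ?_⟩
  rw [integral_const_mul, Measure.integral_comp_mul_left
    (fun y : ℝ => (Real.sigmoid y : ℂ) ^ u * (1 - (Real.sigmoid y : ℂ)) ^ (1 - u)) β,
    integral_sigmoid_cpow_mul, betaIntegral_one_sub hu hu', h_sin, abs_of_pos (inv_pos.2 hβ),
    Complex.real_smul]
  push_cast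
  ring
end

section
/- Let ρ be a density matrix, α ∈ [0,1], and A a complex matrix of the same size. Then tr(ρ^{1−α} A ρ^{α} Aᴴ) is a nonnegative real number and satisfies the Hölder-type inequality tr(ρ^{1−α} A ρ^{α} Aᴴ) ≤ (tr(ρ A Aᴴ))^{1−α} · (tr(ρ Aᴴ A))^{α}, where Aᴴ is the conjugate transpose. -/
open scoped BigOperators ComplexOrder Matrix
open Classical

namespace QCpaper

variable {n : Type*} [Fintype n] [DecidableEq n]

/-- A density matrix: positive semidefinite with unit trace. -/
def IsDensityMatrix (ρ : Matrix n n ℂ) : Prop :=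
  ρ.PosSemidef ∧ ρ.trace = 1

/-- Real power `ρ^α` of a Hermitian matrix by functional calculus (with `0^0 = 1`
via `Real.rpow`); junk value `0` on non-Hermitian input. -/
noncomputable def mpow (ρ : Matrix n n ℂ) (α : ℝ) : Matrix n n ℂ :=
  if h : ρ.IsHermitian then
    (h.eigenvectorUnitary : Matrix n n ℂ) *
      Matrix.diagonal (fun i => ((h.eigenvalues i ^ α : ℝ) : ℂ)) *
      star (h.eigenvectorUnitary : Matrix n n ℂ)
  else 0

/-- Hölder's inequality for finite sums, in the form of log-convexity in the exponent. -/
theorem sum_rpow_mul_rpow_le {ι : Type*} (s : Finset ι) (f g : ι → ℝ)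
    (hf : ∀ i ∈ s, 0 ≤ f i) (hg : ∀ i ∈ s, 0 ≤ g i) {α : ℝ} (hα0 : 0 ≤ α) (hα1 : α ≤ 1) :
    ∑ i ∈ s, f i ^ (1 - α) * g i ^ α ≤ (∑ i ∈ s, f i) ^ (1 - α) * (∑ i ∈ s, g i) ^ α := by
  rcases hα0.eq_or_lt with rfl | h0
  · simp
  rcases hα1.eq_or_lt with rfl | h1
  · simp
  have hβ : 0 < 1 - α := sub_pos.mpr h1
  have hpq : (1 - α)⁻¹.HolderConjugate α⁻¹ :=
    Real.holderConjugate_iff.mpr ⟨(one_lt_inv₀ hβ).mpr (by linarith), by simp⟩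
  have h := Real.inner_le_Lp_mul_Lq_of_nonneg s hpq
    (fun i hi => Real.rpow_nonneg (hf i hi) (1 - α)) (fun i hi => Real.rpow_nonneg (hg i hi) α)
  simp only [one_div, inv_inv] at h
  rwa [Finset.sum_congr rfl fun i hi => Real.rpow_rpow_inv (hf i hi) hβ.ne',
    Finset.sum_congr rfl fun i hi => Real.rpow_rpow_inv (hg i hi) h0.ne'] at h

theorem trace_diagonal_mul_mul_diagonal_mul_conjTranspose (d e : n → ℝ) (B : Matrix n n ℂ) :
    (Matrix.diagonal (fun i => (d i : ℂ)) * B * Matrix.diagonal (fun i => (e i : ℂ)) * Bᴴ).trace =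
      ((∑ p : n × n, d p.1 * e p.2 * Complex.normSq (B p.1 p.2) : ℝ) : ℂ) := by
  rw [Fintype.sum_prod_type, Matrix.trace]
  push_cast
  refine Finset.sum_congr rfl fun i _ => ?_
  rw [Matrix.diag_apply, Matrix.mul_apply]
  refine Finset.sum_congr rfl fun j _ => ?_
  rw [Matrix.mul_diagonal, Matrix.diagonal_mul, Matrix.conjTranspose_apply,
    Complex.normSq_eq_conj_mul_self, starRingEnd_apply]
  ring

/-- The trace of `ρ^s A ρ^t Aᴴ` in terms of the entries of `A` in an eigenbasis of `ρ`. -/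
theorem trace_mpow_mul_mul_mpow_mul_conjTranspose {ρ : Matrix n n ℂ} (h : ρ.IsHermitian)
    (A : Matrix n n ℂ) (s t : ℝ) :
    (mpow ρ s * A * mpow ρ t * Aᴴ).trace =
      ((∑ p : n × n, h.eigenvalues p.1 ^ s * h.eigenvalues p.2 ^ t *
        Complex.normSq ((star (h.eigenvectorUnitary : Matrix n n ℂ) * A *
          (h.eigenvectorUnitary : Matrix n n ℂ)) p.1 p.2) : ℝ) : ℂ) := by
  refine Eq.trans ?_ (trace_diagonal_mul_mul_diagonal_mul_conjTranspose
    (fun i => h.eigenvalues i ^ s) (fun i => h.eigenvalues i ^ t) _)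
  simp only [mpow, dif_pos h, Matrix.star_eq_conjTranspose, Matrix.conjTranspose_mul,
    Matrix.conjTranspose_conjTranspose, Matrix.mul_assoc]
  rw [Matrix.trace_mul_comm]
  simp only [Matrix.mul_assoc]

theorem mpow_zero {ρ : Matrix n n ℂ} (h : ρ.IsHermitian) : mpow ρ 0 = 1 := by
  simp [mpow, dif_pos h]

theorem mpow_one {ρ : Matrix n n ℂ} (h : ρ.IsHermitian) : mpow ρ 1 = ρ := by
  conv_rhs => rw [h.spectral_theorem]
  simp [mpow, dif_pos h, Unitary.conjStarAlgAut_apply, Function.comp_def]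

/-- Hölder-type inequality: for a density matrix `ρ`, `α ∈ [0,1]` and any matrix `A`,
`tr(ρ^{1−α} A ρ^α Aᴴ)` is a nonnegative real number and
`tr(ρ^{1−α} A ρ^α Aᴴ) ≤ (tr(ρAAᴴ))^{1−α}·(tr(ρAᴴA))^α`. -/
theorem trace_mpow_holder (ρ : Matrix n n ℂ) (hρ : IsDensityMatrix ρ)
    (α : ℝ) (hα0 : 0 ≤ α) (hα1 : α ≤ 1) (A : Matrix n n ℂ) :
    ((mpow ρ (1 - α) * A * mpow ρ α * Aᴴ).trace).im = 0 ∧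
    0 ≤ ((mpow ρ (1 - α) * A * mpow ρ α * Aᴴ).trace).re ∧
    ((mpow ρ (1 - α) * A * mpow ρ α * Aᴴ).trace).re ≤
      ((ρ * A * Aᴴ).trace).re ^ (1 - α) * ((ρ * Aᴴ * A).trace).re ^ α := by
  have h := hρ.1.isHermitian
  have hev := hρ.1.eigenvalues_nonneg
  have hl : (ρ * A * Aᴴ).trace = (mpow ρ 1 * A * mpow ρ 0 * Aᴴ).trace := by
    rw [mpow_one h, mpow_zero h, Matrix.mul_one]
  have hr : (ρ * Aᴴ * A).trace = (mpow ρ 0 * A * mpow ρ 1 * Aᴴ).trace := by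
    rw [mpow_one h, mpow_zero h, Matrix.one_mul, Matrix.trace_mul_comm, Matrix.mul_assoc]
  rw [hl, hr]
  simp only [trace_mpow_mul_mul_mpow_mul_conjTranspose h, Complex.ofReal_re, Complex.ofReal_im,
    Real.rpow_one, Real.rpow_zero, mul_one, one_mul, true_and]
  refine ⟨Finset.sum_nonneg fun p _ => mul_nonneg (mul_nonneg (Real.rpow_nonneg (hev _) _)
    (Real.rpow_nonneg (hev _) _)) (Complex.normSq_nonneg _), ?_⟩
  refine le_trans (Finset.sum_le_sum fun p _ => le_of_eq ?_) (sum_rpow_mul_rpow_le _ _ _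
    (fun p _ => mul_nonneg (hev _) (Complex.normSq_nonneg _))
    (fun p _ => mul_nonneg (hev _) (Complex.normSq_nonneg _)) hα0 hα1)
  have hw := Complex.normSq_nonneg ((star (h.eigenvectorUnitary : Matrix n n ℂ) * A *
    (h.eigenvectorUnitary : Matrix n n ℂ)) p.1 p.2)
  rw [Real.mul_rpow (hev _) hw, Real.mul_rpow (hev _) hw, mul_mul_mul_comm,
    ← Real.rpow_add_of_nonneg hw (sub_nonneg.mpr hα1) hα0, sub_add_cancel, Real.rpow_one]

end QCpaper
end
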